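/- arXiv:2112.03729 — 2 statements merged into one kernel-verified Lean document; each statement's English description precedes it below -/
import Mathlib

section
/- Let n ≥ 2 and g ∈ C²([−1,1]), and for f ∈ C(𝕊^{n−1}) let T_g f(u) = ∫_{𝕊^{n−1}} g(u·v) f(v) dv. Then T_g f extends to a C² function on ℝⁿ∖{0} by 1-homogeneity, and for all u ∈ 𝕊^{n−1} and all j,l ∈ {1,…,n}, the entries of the Hessian of this extension are ∇²_{jl}(T_g f)(u) = ∫_{𝕊^{n−1}} [ g(u·v)(δ_{jl} − u_j u_l) − g'(u·v)(u·v)(δ_{jl} − u_j u_l) + g''(u·v)(v_j − (u·v)u_j)(v_l − (u·v)u_l) ] f(v) dv. -/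
open scoped InnerProductSpace Pointwise
open MeasureTheory Metric Filter Topology

noncomputable section

/-- Euclidean space `ℝⁿ`. -/
abbrev En (n : ℕ) := EuclideanSpace ℝ (Fin n)

namespace MinkIter

variable {n : ℕ}

/-- The unit sphere `𝕊^{n-1}` as a subtype. -/
abbrev Sph (n : ℕ) := Metric.sphere (0 : En n) 1

/-- Spherical Lebesgue measure on `𝕊^{n-1}`. -/
def sphVol (n : ℕ) : Measure (Sph n) := (volume : Measure (En n)).toSphere

/-- A fixed pole `ē ∈ 𝕊^{n-1}`. -/
def pole (n : ℕ) : En n :=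
  if h : 0 < n then EuclideanSpace.single (⟨0, h⟩ : Fin n) 1 else 0

/-- The support function of a convex body, as a function on all of `ℝⁿ`. -/
def supp (K : ConvexBody (En n)) (x : En n) : ℝ :=
  sSup ((fun y => ⟪x, y⟫_ℝ) '' (K : Set (En n)))

/-- The Euclidean unit ball `𝔹ⁿ` as a convex body. -/
def ballB (n : ℕ) : ConvexBody (En n) :=
  ⟨closedBall 0 1, convex_closedBall 0 1, isCompact_closedBall 0 1, ⟨0, by simp⟩⟩

/-- The dilate `c • K` of a convex body. -/
def scale (c : ℝ) (K : ConvexBody (En n)) : ConvexBody (En n) :=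
  ⟨c • (K : Set (En n)), K.convex.smul c, K.isCompact.smul c, K.nonempty.smul_set⟩

/-- The translate `K + x` of a convex body. -/
def translate (K : ConvexBody (En n)) (x : En n) : ConvexBody (En n) :=
  ⟨(fun y => x + y) '' (K : Set (En n)), K.convex.translate x,
    K.isCompact.image (continuous_add_left x), K.nonempty.image _⟩

/-- A linear isometry of `ℝⁿ` is a rotation (element of `SO(n)`) if it preserves
orientation. -/
def IsRotation (ρ : En n ≃ₗᵢ[ℝ] En n) : Prop :=
  0 < LinearMap.det (ρ.toLinearEquiv.toLinearMap)

/-- The image `ρ K` of a convex body under a linear isometry. -/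
def rotate (ρ : En n ≃ₗᵢ[ℝ] En n) (K : ConvexBody (En n)) : ConvexBody (En n) :=
  ⟨ρ '' (K : Set (En n)), K.convex.linear_image ρ.toLinearEquiv.toLinearMap,
    K.isCompact.image ρ.continuous, K.nonempty.image _⟩

/-- `Φ` is a Minkowski valuation: `ΦK + ΦL = Φ(K ∪ L) + Φ(K ∩ L)` whenever `K ∪ L`
is convex (Minkowski addition on the left). -/
def IsMinkowskiValuation (Φ : ConvexBody (En n) → ConvexBody (En n)) : Prop :=
  ∀ (K L : ConvexBody (En n)) (hu : Convex ℝ ((K : Set (En n)) ∪ (L : Set (En n))))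
    (hi : ((K : Set (En n)) ∩ (L : Set (En n))).Nonempty),
    Φ K + Φ L =
      Φ ⟨(K : Set (En n)) ∪ (L : Set (En n)), hu, K.isCompact.union L.isCompact,
          K.nonempty.inl⟩ +
      Φ ⟨(K : Set (En n)) ∩ (L : Set (En n)), K.convex.inter L.convex,
          K.isCompact.inter_right L.isCompact.isClosed, hi⟩

/-- `Φ` is translation invariant. -/
def TranslationInvariant (Φ : ConvexBody (En n) → ConvexBody (En n)) : Prop :=
  ∀ (K : ConvexBody (En n)) (x : En n), Φ (translate K x) = Φ K

/-- `Φ` is (positively) homogeneous of degree `i`. -/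
def HasDegree (i : ℕ) (Φ : ConvexBody (En n) → ConvexBody (En n)) : Prop :=
  ∀ (K : ConvexBody (En n)) (c : ℝ), 0 ≤ c → Φ (scale c K) = scale (c ^ i) (Φ K)

/-- `Φ` commutes with `SO(n)`. -/
def RotationEquivariant (Φ : ConvexBody (En n) → ConvexBody (En n)) : Prop :=
  ∀ ρ : En n ≃ₗᵢ[ℝ] En n, IsRotation ρ → ∀ K, Φ (rotate ρ K) = rotate ρ (Φ K)

/-- `Φ` is even: `Φ(-K) = ΦK`. -/
def IsEven (Φ : ConvexBody (En n) → ConvexBody (En n)) : Prop :=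
  ∀ K, Φ (scale (-1) K) = Φ K

/-- `Φ` is monotone w.r.t. set inclusion. -/
def MonotoneVal (Φ : ConvexBody (En n) → ConvexBody (En n)) : Prop :=
  ∀ K L : ConvexBody (En n), (K : Set (En n)) ⊆ (L : Set (En n)) →
    (Φ K : Set (En n)) ⊆ (Φ L : Set (En n))

/-- `Φ` is non-trivial: `ΦK ≠ {o}` for some `K`. -/
def NontrivialVal (Φ : ConvexBody (En n) → ConvexBody (En n)) : Prop :=
  ∃ K : ConvexBody (En n), (Φ K : Set (En n)) ≠ {0}

/-- The mixed volume `V(K₁,…,Kₙ)`, via polarization of the volume. -/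
def mixedVol (Ks : Fin n → ConvexBody (En n)) : ℝ :=
  ((n.factorial : ℝ))⁻¹ *
    ∑ S : Finset (Fin n), (-1 : ℝ) ^ (n - S.card) *
      (volume ((∑ k ∈ S, Ks k : ConvexBody (En n)) : Set (En n))).toReal

/-- `κ_m`, the volume of the `m`-dimensional unit ball. -/
def kappa (m : ℕ) : ℝ := (volume (closedBall (0 : En m) 1)).toReal

/-- `ω_m`, the surface area of the `m`-dimensional unit ball. -/
def omegaS (m : ℕ) : ℝ := m * kappa m

/-- The `j`-th intrinsic volume `V_j(K) = binom(n,j) V(K[j],𝔹ⁿ[n-j]) / κ_{n-j}`. -/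
def intrinsicVol (j : ℕ) (K : ConvexBody (En n)) : ℝ :=
  (n.choose j : ℝ) / kappa (n - j) *
    mixedVol (fun k : Fin n => if (k : ℕ) < j then K else ballB n)

/-- `μ` is the area measure of order `i` of `K`: for every convex body `L`,
`∫ h_L dμ = n V(L, K[i], 𝔹ⁿ[n-1-i])`. -/
def IsAreaMeasure (i : ℕ) (K : ConvexBody (En n)) (μ : Measure (Sph n)) : Prop :=
  ∀ L : ConvexBody (En n),
    (∫ v : Sph n, supp L (v : En n) ∂μ) =
      n * mixedVol (fun k : Fin n =>
        if (k : ℕ) = 0 then L else if (k : ℕ) ≤ i then K else ballB n)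

/-- `Φ` is generated by the zonal function with profile `g : [-1,1] → ℝ`, i.e.
`h_{ΦK} = S_i(K,·) ∗ g` where `∗` is the spherical convolution. -/
def GeneratedBy (i : ℕ) (Φ : ConvexBody (En n) → ConvexBody (En n)) (g : ℝ → ℝ) : Prop :=
  ∀ (K : ConvexBody (En n)) (μ : Measure (Sph n)), IsAreaMeasure i K μ →
    ∀ u : En n, ‖u‖ = 1 →
      supp (Φ K) u = ∫ v : Sph n, g ⟪u, (v : En n)⟫_ℝ ∂μ

/-- `L` is a body of revolution: invariant under all rotations fixing the pole. -/
def IsZonalBody (L : ConvexBody (En n)) : Prop :=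
  ∀ ρ : En n ≃ₗᵢ[ℝ] En n, IsRotation ρ → ρ (pole n) = pole n → rotate ρ L = L

/-- The quadratic form of the Hessian of `F` at `u` in direction `w`. -/
def hessQ (F : En n → ℝ) (u w : En n) : ℝ := iteratedFDeriv ℝ 2 F u ![w, w]

/-- `(j,l)` entry of the Hessian of `F` at `u`. -/
def hessE (F : En n → ℝ) (u : En n) (j l : Fin n) : ℝ :=
  iteratedFDeriv ℝ 2 F u ![EuclideanSpace.single j 1, EuclideanSpace.single l 1]

/-- A convex body is of class `C^k₊` if its support function is of class `C^k`
away from the origin and the restriction of its Hessian to `u^⊥` is positive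
definite for every unit vector `u`. -/
def IsCkPlus (k : ℕ∞) (L : ConvexBody (En n)) : Prop :=
  ContDiffOn ℝ k (supp L) {0}ᶜ ∧
    ∀ u : En n, ‖u‖ = 1 → ∀ w : En n, w ≠ 0 → ⟪u, w⟫_ℝ = 0 → 0 < hessQ (supp L) u w

/-- `Φ` is a `C^∞₊` regular Minkowski valuation of degree `i`: it is generated by
the support function of a body of revolution of class `C^∞₊`. -/
def CInfRegular (i : ℕ) (Φ : ConvexBody (En n) → ConvexBody (En n)) : Prop :=
  ∃ (L : ConvexBody (En n)) (g : ℝ → ℝ), IsZonalBody L ∧ IsCkPlus ⊤ L ∧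
    (∀ u : En n, ‖u‖ = 1 → supp L u = g ⟪u, pole n⟫_ℝ) ∧ GeneratedBy i Φ g

/-- The `C²(𝕊^{n-1})` distance of two functions. -/
def C2dist (F G : En n → ℝ) : ℝ :=
  ⨆ u : Sph n, (|F (u : En n) - G (u : En n)| +
    ‖fderiv ℝ F (u : En n) - fderiv ℝ G (u : En n)‖ +
    ‖iteratedFDeriv ℝ 2 F (u : En n) - iteratedFDeriv ℝ 2 G (u : En n)‖)

/-- The Legendre polynomial of dimension `d` and degree `k` (Rodrigues formula). -/
def legendreP (d k : ℕ) (t : ℝ) : ℝ :=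
  (-1 : ℝ) ^ k *
    (Real.Gamma (((d : ℝ) - 1) / 2) / (2 ^ k * Real.Gamma (((d : ℝ) - 1) / 2 + k))) *
    (1 - t ^ 2) ^ (-(((d : ℝ) - 3) / 2)) *
    iteratedDeriv k (fun s : ℝ => (1 - s ^ 2) ^ ((((d : ℝ) - 3) / 2) + (k : ℝ))) t

/-- The multiplier `a_k^d[h]` of a zonal function with profile `h : [-1,1] → ℝ`. -/
def multInt (d k : ℕ) (h : ℝ → ℝ) : ℝ :=
  omegaS (d - 1) *
    ∫ t in (-1 : ℝ)..1, legendreP d k t * h t * (1 - t ^ 2) ^ (((d : ℝ) - 3) / 2)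

/-- The multiplier `a_k^n[f] = ∫_{𝕊^{n-1}} f(u) P_k^n(ē·u) du` of a zonal function
`f` on the sphere. -/
def multSph (k : ℕ) (f : En n → ℝ) : ℝ :=
  ∫ u : Sph n, f (u : En n) * legendreP n k ⟪pole n, (u : En n)⟫_ℝ ∂(sphVol n)

/-- The projection `π₀ f` of `f` onto the constants (its mean value). -/
def proj0 (f : En n → ℝ) : ℝ :=
  (omegaS n)⁻¹ * ∫ u : Sph n, f (u : En n) ∂(sphVol n)

/-- The `L²(𝕊^{n-1})` norm. -/
def sphL2 (f : En n → ℝ) : ℝ :=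
  Real.sqrt (∫ u : Sph n, (f (u : En n)) ^ 2 ∂(sphVol n))

/-- The sup norm on the sphere. -/
def supSph (f : En n → ℝ) : ℝ := ⨆ u : Sph n, |f (u : En n)|

/-- `M ∈ UBounds α f` iff `M` witnesses `‖f‖_{𝒰_α} ≤ M`: `‖f‖_∞ ≤ M` and for every
`k ≥ 1` there is a polynomial of degree at most `k` with `‖f - p_k‖_{L²} ≤ M k^{-α}`. -/
def UBounds (α : ℝ) (f : En n → ℝ) : Set ℝ :=
  {M | (∀ u : En n, ‖u‖ = 1 → |f u| ≤ M) ∧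
    ∀ k : ℕ, 0 < k → ∃ p : MvPolynomial (Fin n) ℝ, p.totalDegree ≤ k ∧
      sphL2 (fun x => f x - MvPolynomial.eval (fun j => x j) p) ≤ M * (k : ℝ) ^ (-α)}

/-- `f ∈ 𝒰_α`. -/
def MemU (α : ℝ) (f : En n → ℝ) : Prop := (UBounds α f).Nonempty

/-- The norm `‖f‖_{𝒰_α}`. -/
def UNorm (α : ℝ) (f : En n → ℝ) : ℝ := sInf (UBounds α f)

/-- The convolution transform `T_g f` with zonal kernel of profile `g`, extended
1-homogeneously to `ℝⁿ`: `(T_g f)(u) = ∫_{𝕊^{n-1}} g(u·v) f(v) dv` for unit `u`. -/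
def Tg (g : ℝ → ℝ) (f : En n → ℝ) (x : En n) : ℝ :=
  ‖x‖ * ∫ v : Sph n, g ⟪‖x‖⁻¹ • x, (v : En n)⟫_ℝ * f (v : En n) ∂(sphVol n)

/-- The 0-homogeneous extension of a function on the sphere. -/
def zeroExt (f : En n → ℝ) (x : En n) : ℝ := f (‖x‖⁻¹ • x)

/-- The spherical Laplacian `Δ_𝕊 f`, i.e. the Euclidean Laplacian of the
0-homogeneous extension. -/
def sphLap (f : En n → ℝ) (u : En n) : ℝ := ∑ j : Fin n, hessE (zeroExt f) u j j

/-- The operator `□_n f = f + Δ_𝕊 f /(n-1)`. -/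
def boxN (f : En n → ℝ) (u : En n) : ℝ := f u + ((n : ℝ) - 1)⁻¹ * sphLap f u

/-- The mixed discriminant of `m` symmetric `m × m` matrices, via polarization of
the determinant. -/
def mixedDisc {m : ℕ} (A : Fin m → Matrix (Fin m) (Fin m) ℝ) : ℝ :=
  ((m.factorial : ℝ))⁻¹ *
    ∑ S : Finset (Fin m), (-1 : ℝ) ^ (m - S.card) * (∑ k ∈ S, A k).det

/-- The rank one matrix `u ⊗ u`. -/
def outer (u : En n) : Matrix (Fin n) (Fin n) ℝ := Matrix.of fun j l => u j * u l

/-- The matrix of the orthogonal projection onto `u^⊥`. -/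
def projMat (u : En n) : Matrix (Fin n) (Fin n) ℝ := 1 - outer u

/-- The Hessian matrix of `F` at `u`. -/
def hessMat (F : En n → ℝ) (u : En n) : Matrix (Fin n) (Fin n) ℝ :=
  Matrix.of fun j l => hessE F u j l

/-- The mixed discriminant `D_{n-1}(B₁|_{u^⊥},…,B_{n-1}|_{u^⊥})` of the restrictions
to `u^⊥` of matrices annihilating `u`, computed via the identity
`D_{n-1}(B₁|_{u^⊥},…) = n · D_n(u ⊗ u, B₁,…,B_{n-1})`. -/
def restrDisc (u : En n) (B : Fin (n - 1) → Matrix (Fin n) (Fin n) ℝ) : ℝ :=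
  n * mixedDisc (fun k : Fin n =>
    if h : (k : ℕ) = 0 then outer u else B ⟨(k : ℕ) - 1, by have := k.isLt; omega⟩)

/-- Total variation distance between two Borel measures on the sphere. -/
def dTV (μ ν : Measure (Sph n)) : ℝ :=
  ⨆ A : {A : Set (Sph n) // MeasurableSet A}, |(μ A).toReal - (ν A).toReal|

/-- Lévy–Prokhorov distance between two Borel measures on the sphere. -/
def dLP (μ ν : Measure (Sph n)) : ℝ :=
  sInf {ε : ℝ | 0 < ε ∧ ∀ A : Set (Sph n), MeasurableSet A →
    μ A ≤ ν (Metric.thickening ε A) + ENNReal.ofReal ε ∧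
    ν A ≤ μ (Metric.thickening ε A) + ENNReal.ofReal ε}

/-- Two convex bodies are homothetic: one is a translate of a positive dilate of
the other. -/
def Homothetic (K L : ConvexBody (En n)) : Prop :=
  ∃ (c : ℝ) (x : En n), 0 < c ∧ (L : Set (En n)) = x +ᵥ c • (K : Set (En n))

/-- The dimension of a convex body (dimension of its affine hull). -/
def bodyDim (K : ConvexBody (En n)) : ℕ :=
  Module.finrank ℝ (vectorSpan ℝ (K : Set (En n)))

/-- `K` is a Euclidean ball. -/
def IsBall (K : ConvexBody (En n)) : Prop :=
  ∃ (c : En n) (r : ℝ), 0 < r ∧ (K : Set (En n)) = closedBall c r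

/-- The mean width `w(K) = (2/ω_n) ∫_{𝕊^{n-1}} h_K`. -/
def meanWidth (K : ConvexBody (En n)) : ℝ :=
  2 / omegaS n * ∫ u : Sph n, supp K (u : En n) ∂(sphVol n)

/-- `N(n,k)`, the dimension of the space of spherical harmonics of dimension `n`
and degree `k`. -/
def Nnk (n k : ℕ) : ℝ :=
  (((n : ℝ) + 2 * k - 2) / ((n : ℝ) + k - 2)) * (Nat.choose (n + k - 2) (n - 2) : ℝ)

theorem hasFDerivAt_integral_of_continuousOn_compactSpace
    {E F X : Type*} [NormedAddCommGroup E] [NormedSpace ℝ E] [LocallyCompactSpace E]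
    [NormedAddCommGroup F] [NormedSpace ℝ F] [TopologicalSpace X] [CompactSpace X]
    [MeasurableSpace X] [OpensMeasurableSpace X] [SecondCountableTopology X]
    {μ : Measure X} [IsFiniteMeasure μ] {U : Set E} (hU : IsOpen U)
    {K : E → X → F} {K' : E → X → E →L[ℝ] F}
    (hK : ContinuousOn K.uncurry (U ×ˢ Set.univ))
    (hK' : ContinuousOn K'.uncurry (U ×ˢ Set.univ))
    (h : ∀ x ∈ U, ∀ v, HasFDerivAt (fun y => K y v) (K' x v) x) {x : E} (hx : x ∈ U) :
    HasFDerivAt (fun y => ∫ v, K y v ∂μ) (∫ v, K' x v ∂μ) x := by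
  obtain ⟨s, hs, hsU, hsc⟩ := LocallyCompactSpace.local_compact_nhds x U (hU.mem_nhds hx)
  obtain ⟨M, hM⟩ := ((hsc.prod isCompact_univ).bddAbove_image
    (hK'.mono (Set.prod_mono_left hsU)).norm)
  have hc : ∀ y ∈ U, Continuous (K y) := fun y hy =>
    hK.comp_continuous (f := fun v => (y, v)) (by fun_prop) (fun v => by simp [hy])
  have hc' : ∀ y ∈ U, Continuous (K' y) := fun y hy =>
    hK'.comp_continuous (f := fun v => (y, v)) (by fun_prop) (fun v => by simp [hy])
  refine hasFDerivAt_integral_of_dominated_of_fderiv_le (bound := fun _ => M) hs ?_ ?_ ?_ ?_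
    (integrable_const M) (Eventually.of_forall fun v y hy => h y (hsU hy) v)
  · filter_upwards [hU.mem_nhds hx] with y hy
    exact (hc y hy).aestronglyMeasurable_of_compactSpace
  · exact (hc x hx).integrable_of_hasCompactSupport (HasCompactSupport.of_compactSpace _)
  · exact (hc' x hx).aestronglyMeasurable_of_compactSpace
  · exact Eventually.of_forall fun v y hy => hM ⟨(y, v), ⟨hy, Set.mem_univ _⟩, rfl⟩

theorem exists_hasDerivAt_extension_Icc {a b : ℝ} {g g' : ℝ → ℝ}
    (hg : ∀ t ∈ Set.Icc a b, HasDerivWithinAt g (g' t) (Set.Icc a b) t)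
    {G' : ℝ → ℝ} (hG' : Continuous G') (h : Set.EqOn G' g' (Set.Icc a b)) :
    ∃ G : ℝ → ℝ, (∀ t, HasDerivAt G (G' t) t) ∧ Set.EqOn G g (Set.Icc a b) := by
  have hd : ∀ t, HasDerivAt (fun t => g a + ∫ s in a..t, G' s) (G' t) t := fun t =>
    (intervalIntegral.integral_hasDerivAt_right (hG'.intervalIntegrable _ _)
      hG'.stronglyMeasurable.stronglyMeasurableAtFilter hG'.continuousAt).const_add _
  refine ⟨_, hd, ?_⟩
  have hI : ∀ t ∈ Set.Ico a b, Set.Icc a b ∈ 𝓝[≥] t := fun t ht =>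
    Icc_mem_nhdsGE_of_mem ht
  refine eq_of_has_deriv_right_eq (f' := g') (fun t ht => ?_) (fun t ht => ?_)
    (fun t _ => (hd t).continuousAt.continuousWithinAt)
    (fun t ht => (hg t ht).continuousWithinAt) (by simp)
  · rw [← h (Set.Ico_subset_Icc_self ht)]
    exact (hd t).hasDerivWithinAt
  · exact (hg t (Set.Ico_subset_Icc_self ht)).mono_of_mem_nhdsWithin (hI t ht)

theorem exists_C2_extension_Icc {a b : ℝ} (hab : a < b) {g : ℝ → ℝ}
    (hg : ContDiffOn ℝ 2 g (Set.Icc a b)) :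
    ∃ G G₁ G₂ : ℝ → ℝ, (∀ t, HasDerivAt G (G₁ t) t) ∧ (∀ t, HasDerivAt G₁ (G₂ t) t) ∧
      Continuous G₂ ∧ Set.EqOn G g (Set.Icc a b) ∧
      Set.EqOn G₁ (derivWithin g (Set.Icc a b)) (Set.Icc a b) ∧
      Set.EqOn G₂ (derivWithin (derivWithin g (Set.Icc a b)) (Set.Icc a b)) (Set.Icc a b) := by
  have hu : UniqueDiffOn ℝ (Set.Icc a b) := uniqueDiffOn_Icc hab
  have h1 : ContDiffOn ℝ 1 (derivWithin g (Set.Icc a b)) (Set.Icc a b) :=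
    hg.derivWithin hu (by norm_num)
  have h2 : ContinuousOn (derivWithin (derivWithin g (Set.Icc a b)) (Set.Icc a b))
      (Set.Icc a b) := h1.continuousOn_derivWithin hu le_rfl
  obtain ⟨G₂, hc, he₂⟩ : ∃ G₂ : ℝ → ℝ, Continuous G₂ ∧
      Set.EqOn G₂ (derivWithin (derivWithin g (Set.Icc a b)) (Set.Icc a b)) (Set.Icc a b) :=
    ⟨_, h2.domRestrict.Icc_extend' (h := hab.le), fun t ht => Set.IccExtend_of_mem _ _ ht⟩
  obtain ⟨G₁, hd₁, he₁⟩ := exists_hasDerivAt_extension_Icc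
    (fun t ht => (h1.differentiableOn one_ne_zero t ht).hasDerivWithinAt) hc he₂
  obtain ⟨G, hd, he⟩ := exists_hasDerivAt_extension_Icc
    (fun t ht => (hg.differentiableOn two_ne_zero t ht).hasDerivWithinAt)
    (continuous_iff_continuousAt.2 fun t => (hd₁ t).continuousAt) he₁
  exact ⟨G, G₁, G₂, hd, hd₁, hc, he, he₁, he₂⟩

section Kernel

variable {E : Type*} [NormedAddCommGroup E] [InnerProductSpace ℝ E]

theorem hasFDerivAt_norm_of_ne_zero {x : E} (hx : x ≠ 0) :
    HasFDerivAt (fun y : E => ‖y‖) (innerSL ℝ (‖x‖⁻¹ • x)) x := by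
  have h := (hasStrictFDerivAt_norm_sq x).hasFDerivAt.sqrt (by simpa using hx)
  simp only [Real.sqrt_sq (norm_nonneg _)] at h
  refine h.congr_fderiv ?_
  ext y
  simp
  field_simp

/-- The derivative at `x` of the radial projection `y ↦ ‖y‖⁻¹ • y` onto the unit sphere. -/
def radialProjDeriv (x : E) : E →L[ℝ] E :=
  ‖x‖⁻¹ • (ContinuousLinearMap.id ℝ E -
    (innerSL ℝ (‖x‖⁻¹ • x)).smulRight (‖x‖⁻¹ • x))

theorem hasFDerivAt_radialProj {x : E} (hx : x ≠ 0) :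
    HasFDerivAt (fun y : E => ‖y‖⁻¹ • y) (radialProjDeriv x) x := by
  have hn : ‖x‖ ≠ 0 := norm_ne_zero_iff.2 hx
  have h := ((hasDerivAt_inv hn).comp_hasFDerivAt x (hasFDerivAt_norm_of_ne_zero hx)).smul
    (hasFDerivAt_id x)
  refine h.congr_fderiv ?_
  ext y
  simp [radialProjDeriv, smul_smul, sub_eq_add_neg]
  congr 1
  field_simp

theorem hasFDerivAt_inner_radialProj {x : E} (hx : x ≠ 0) (v : E) :
    HasFDerivAt (fun y : E => ⟪‖y‖⁻¹ • y, v⟫_ℝ) (innerSL ℝ v ∘L radialProjDeriv x) x := by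
  have h := (innerSL ℝ v).hasFDerivAt.comp x (hasFDerivAt_radialProj hx)
  refine h.congr_of_eventuallyEq (Eventually.of_forall fun y => ?_)
  simp [real_inner_comm]

/-- The gradient at `x` of the 1-homogeneous extension of `u ↦ G ⟪u, v⟫`, where `G₁` is the
derivative of `G`. -/
def zonalGrad (G G₁ : ℝ → ℝ) (x v : E) : E :=
  (G ⟪‖x‖⁻¹ • x, v⟫_ℝ - ⟪‖x‖⁻¹ • x, v⟫_ℝ * G₁ ⟪‖x‖⁻¹ • x, v⟫_ℝ) • (‖x‖⁻¹ • x) +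
    G₁ ⟪‖x‖⁻¹ • x, v⟫_ℝ • v

/-- The Hessian at `x` of the 1-homogeneous extension of `u ↦ G ⟪u, v⟫`, where `G₁` and `G₂` are
the first two derivatives of `G`. -/
def zonalHess (G G₁ G₂ : ℝ → ℝ) (x v : E) : E →L[ℝ] E :=
  (G ⟪‖x‖⁻¹ • x, v⟫_ℝ - ⟪‖x‖⁻¹ • x, v⟫_ℝ * G₁ ⟪‖x‖⁻¹ • x, v⟫_ℝ) • radialProjDeriv x +
    G₂ ⟪‖x‖⁻¹ • x, v⟫_ℝ • (innerSL ℝ v ∘L radialProjDeriv x).smulRight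
      (v - ⟪‖x‖⁻¹ • x, v⟫_ℝ • (‖x‖⁻¹ • x))

theorem hasFDerivAt_zonal {G G₁ : ℝ → ℝ} (hG : ∀ t, HasDerivAt G (G₁ t) t)
    {x : E} (hx : x ≠ 0) (v : E) :
    HasFDerivAt (fun y : E => ‖y‖ * G ⟪‖y‖⁻¹ • y, v⟫_ℝ)
      (innerSL ℝ (zonalGrad G G₁ x v)) x := by
  have hn : ‖x‖ ≠ 0 := norm_ne_zero_iff.2 hx
  have h := (hasFDerivAt_norm_of_ne_zero hx).mul
    ((hG _).comp_hasFDerivAt x (hasFDerivAt_inner_radialProj hx v))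
  refine h.congr_fderiv ?_
  ext y
  simp [radialProjDeriv, zonalGrad, real_inner_smul_right, real_inner_comm]
  field_simp
  ring

theorem hasFDerivAt_zonalGrad {G G₁ G₂ : ℝ → ℝ} (hG : ∀ t, HasDerivAt G (G₁ t) t)
    (hG₁ : ∀ t, HasDerivAt G₁ (G₂ t) t) {x : E} (hx : x ≠ 0) (v : E) :
    HasFDerivAt (fun y : E => zonalGrad G G₁ y v) (zonalHess G G₁ G₂ x v) x := by
  have ht := hasFDerivAt_inner_radialProj hx v
  have h0 := (hG _).comp_hasFDerivAt x ht
  have h1 := (hG₁ _).comp_hasFDerivAt x ht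
  have h := ((h0.sub (ht.mul h1)).smul (hasFDerivAt_radialProj hx)).add (h1.smul_const v)
  refine h.congr_fderiv ?_
  ext y
  simp only [zonalHess, add_apply, smul_apply,
    sub_apply, Pi.sub_apply, Pi.mul_apply, ContinuousLinearMap.smulRight_apply, Function.comp_apply,
    smul_eq_mul]
  module

theorem continuousOn_radialProj : ContinuousOn (fun x : E => ‖x‖⁻¹ • x) {0}ᶜ := fun _ hx =>
  (hasFDerivAt_radialProj hx).continuousAt.continuousWithinAt

theorem continuousOn_radialProjDeriv :
    ContinuousOn (fun x : E => radialProjDeriv x) {0}ᶜ := by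
  have h := continuousOn_radialProj (E := E)
  have hi : ContinuousOn (fun x : E => ‖x‖⁻¹) {0}ᶜ :=
    continuous_norm.continuousOn.inv₀ fun x hx => norm_ne_zero_iff.2 hx
  unfold radialProjDeriv
  refine hi.smul (continuousOn_const.sub ?_)
  exact ((ContinuousLinearMap.smulRightL ℝ E E).continuous₂.comp_continuousOn
    (((innerSL ℝ).continuous.comp_continuousOn h).prodMk h))

theorem continuousOn_zonalGrad {G G₁ : ℝ → ℝ} (hG : Continuous G) (hG₁ : Continuous G₁) :
    ContinuousOn (fun p : E × E => zonalGrad G G₁ p.1 p.2) ({0}ᶜ ×ˢ Set.univ) := by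
  have h : ContinuousOn (fun p : E × E => ‖p.1‖⁻¹ • p.1) ({0}ᶜ ×ˢ Set.univ) :=
    continuousOn_radialProj.comp continuousOn_fst fun p hp => hp.1
  unfold zonalGrad
  fun_prop

theorem continuousOn_zonalHess {G G₁ G₂ : ℝ → ℝ} (hG : Continuous G) (hG₁ : Continuous G₁)
    (hG₂ : Continuous G₂) :
    ContinuousOn (fun p : E × E => zonalHess G G₁ G₂ p.1 p.2) ({0}ᶜ ×ˢ Set.univ) := by
  have h : ContinuousOn (fun p : E × E => ‖p.1‖⁻¹ • p.1) ({0}ᶜ ×ˢ Set.univ) :=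
    continuousOn_radialProj.comp continuousOn_fst fun p hp => hp.1
  have hd : ContinuousOn (fun p : E × E => radialProjDeriv p.1) ({0}ᶜ ×ˢ Set.univ) :=
    continuousOn_radialProjDeriv.comp continuousOn_fst fun p hp => hp.1
  have ht : ContinuousOn (fun p : E × E => ⟪‖p.1‖⁻¹ • p.1, p.2⟫_ℝ) ({0}ᶜ ×ˢ Set.univ) := by
    fun_prop
  unfold zonalHess
  refine ContinuousOn.add (by fun_prop) ((hG₂.comp_continuousOn ht).smul ?_)
  refine (ContinuousLinearMap.smulRightL ℝ E E).continuous₂.comp_continuousOn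
    (ContinuousOn.prodMk ?_ (by fun_prop))
  exact ((innerSL ℝ).continuous.comp_continuousOn continuousOn_snd).clm_comp hd

end Kernel

instance : IsFiniteMeasure (sphVol n) :=
  inferInstanceAs (IsFiniteMeasure (volume : Measure (En n)).toSphere)

theorem inner_radialProj_mem_Icc {x : En n} (hx : x ≠ 0) (v : Sph n) :
    ⟪‖x‖⁻¹ • x, (v : En n)⟫_ℝ ∈ Set.Icc (-1 : ℝ) 1 := by
  have h := abs_real_inner_le_norm (‖x‖⁻¹ • x) (v : En n)
  rwa [norm_smul, norm_inv, norm_norm, inv_mul_cancel₀ (norm_ne_zero_iff.2 hx),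
    norm_eq_of_mem_sphere v, one_mul, abs_le] at h

theorem Tg_congr {g G : ℝ → ℝ} (h : Set.EqOn G g (Set.Icc (-1) 1)) (f : En n → ℝ) :
    Tg g f = Tg G f := by
  ext x
  rcases eq_or_ne x 0 with rfl | hx
  · simp [Tg]
  · simp only [Tg, h (inner_radialProj_mem_Icc hx _)]

theorem continuousOn_smul_of_continuousOn_prod {F : Type*} [NormedAddCommGroup F]
    [NormedSpace ℝ F] {f : En n → ℝ} (hf : ContinuousOn f (sphere (0 : En n) 1))
    {K : En n → En n → F} {U : Set (En n)}
    (hK : ContinuousOn (fun p : En n × En n => K p.1 p.2) (U ×ˢ Set.univ)) :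
    ContinuousOn (Function.uncurry fun (x : En n) (v : Sph n) => f v • K x v)
      (U ×ˢ Set.univ) := by
  have hfc : Continuous fun v : Sph n => f v := hf.domRestrict
  exact (hfc.comp continuous_snd).continuousOn.smul
    (hK.comp (f := fun p : En n × Sph n => (p.1, (p.2 : En n))) (by fun_prop)
      fun p hp => ⟨hp.1, Set.mem_univ _⟩)

theorem integrable_smul_of_continuousOn_prod {F : Type*} [NormedAddCommGroup F]
    [NormedSpace ℝ F] {f : En n → ℝ} (hf : ContinuousOn f (sphere (0 : En n) 1))
    {K : En n → En n → F} {U : Set (En n)}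
    (hK : ContinuousOn (fun p : En n × En n => K p.1 p.2) (U ×ˢ Set.univ))
    {x : En n} (hx : x ∈ U) :
    Integrable (fun v : Sph n => f v • K x v) (sphVol n) :=
  ((continuousOn_smul_of_continuousOn_prod hf hK).comp_continuous (f := fun v => (x, v))
    (by fun_prop) (fun v => by simp [hx])).integrable_of_hasCompactSupport
    (HasCompactSupport.of_compactSpace _)

theorem hasFDerivAt_Tg {G G₁ : ℝ → ℝ} (hG : ∀ t, HasDerivAt G (G₁ t) t)
    {f : En n → ℝ} (hf : ContinuousOn f (sphere (0 : En n) 1)) (hG₁ : Continuous G₁) {x : En n} (hx : x ≠ 0) :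
    HasFDerivAt (Tg G f)
      (innerSL ℝ (∫ v : Sph n, f v • zonalGrad G G₁ x (v : En n) ∂(sphVol n))) x := by
  have hGc : Continuous G := continuous_iff_continuousAt.2 fun t => (hG t).continuousAt
  have hgrad := continuousOn_zonalGrad (E := En n) hGc hG₁
  have h : ContinuousOn (fun p : En n × En n => ‖p.1‖⁻¹ • p.1) ({0}ᶜ ×ˢ Set.univ) :=
    continuousOn_radialProj.comp continuousOn_fst fun p hp => hp.1
  have hD := hasFDerivAt_integral_of_continuousOn_compactSpace (μ := sphVol n)
    isOpen_compl_singleton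
    (continuousOn_smul_of_continuousOn_prod hf
      (K := fun x v => ‖x‖ * G ⟪‖x‖⁻¹ • x, v⟫_ℝ) (by fun_prop))
    (continuousOn_smul_of_continuousOn_prod hf
      (K := fun x v => innerSL ℝ (zonalGrad G G₁ x v)) ((innerSL ℝ).continuous.comp_continuousOn hgrad))
    (fun y hy v => (hasFDerivAt_zonal hG hy (v : En n)).const_smul (f v)) hx
  have hint := integrable_smul_of_continuousOn_prod hf hgrad hx
  refine (hD.congr_fderiv ?_).congr_of_eventuallyEq (Eventually.of_forall fun y => ?_)
  · rw [← (innerSL ℝ).integral_comp_comm hint]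
    simp
  · rw [Tg, ← integral_const_mul]
    exact integral_congr_ae (Eventually.of_forall fun v => by simp only [smul_eq_mul]; ring)

theorem hasFDerivAt_integral_zonalGrad {G G₁ G₂ : ℝ → ℝ} (hG : ∀ t, HasDerivAt G (G₁ t) t)
    (hG₁ : ∀ t, HasDerivAt G₁ (G₂ t) t) (hG₂ : Continuous G₂)
    {f : En n → ℝ} (hf : ContinuousOn f (sphere (0 : En n) 1))
    {x : En n} (hx : x ≠ 0) :
    HasFDerivAt (fun y => ∫ v : Sph n, f v • zonalGrad G G₁ y (v : En n) ∂(sphVol n))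
      (∫ v : Sph n, f v • zonalHess G G₁ G₂ x (v : En n) ∂(sphVol n)) x := by
  have hGc : Continuous G := continuous_iff_continuousAt.2 fun t => (hG t).continuousAt
  have hGc₁ : Continuous G₁ := continuous_iff_continuousAt.2 fun t => (hG₁ t).continuousAt
  exact hasFDerivAt_integral_of_continuousOn_compactSpace isOpen_compl_singleton
    (continuousOn_smul_of_continuousOn_prod hf (continuousOn_zonalGrad hGc hGc₁))
    (continuousOn_smul_of_continuousOn_prod hf (continuousOn_zonalHess hGc hGc₁ hG₂))
    (fun y hy v => (hasFDerivAt_zonalGrad hG hG₁ hy (v : En n)).const_smul (f v)) hx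

theorem hasFDerivAt_fderiv_Tg {G G₁ G₂ : ℝ → ℝ} (hG : ∀ t, HasDerivAt G (G₁ t) t)
    (hG₁ : ∀ t, HasDerivAt G₁ (G₂ t) t) (hG₂ : Continuous G₂)
    {f : En n → ℝ} (hf : ContinuousOn f (sphere (0 : En n) 1))
    {x : En n} (hx : x ≠ 0) :
    HasFDerivAt (fderiv ℝ (Tg G f))
      (innerSL ℝ ∘L ∫ v : Sph n, f v • zonalHess G G₁ G₂ x (v : En n) ∂(sphVol n)) x := by
  have hGc₁ : Continuous G₁ := continuous_iff_continuousAt.2 fun t => (hG₁ t).continuousAt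
  refine ((innerSL ℝ).hasFDerivAt.comp x
    (hasFDerivAt_integral_zonalGrad hG hG₁ hG₂ hf hx)).congr_of_eventuallyEq ?_
  filter_upwards [isOpen_compl_singleton.mem_nhds hx] with y hy
  exact (hasFDerivAt_Tg hG hf hGc₁ hy).fderiv

theorem contDiffOn_two_Tg {G G₁ G₂ : ℝ → ℝ} (hG : ∀ t, HasDerivAt G (G₁ t) t)
    (hG₁ : ∀ t, HasDerivAt G₁ (G₂ t) t) (hG₂ : Continuous G₂)
    {f : En n → ℝ} (hf : ContinuousOn f (sphere (0 : En n) 1)) :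
    ContDiffOn ℝ 2 (Tg G f) {0}ᶜ := by
  have hGc : Continuous G := continuous_iff_continuousAt.2 fun t => (hG t).continuousAt
  have hGc₁ : Continuous G₁ := continuous_iff_continuousAt.2 fun t => (hG₁ t).continuousAt
  have ho : IsOpen ({0}ᶜ : Set (En n)) := isOpen_compl_singleton
  have hH : ContinuousOn
      (fun x => ∫ v : Sph n, f v • zonalHess G G₁ G₂ x (v : En n) ∂(sphVol n)) {0}ᶜ :=
    continuousOn_integral_of_compact_support isCompact_univ
      (continuousOn_smul_of_continuousOn_prod hf (K := fun x v => zonalHess G G₁ G₂ x v)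
        (continuousOn_zonalHess hGc hGc₁ hG₂))
      fun _ v _ hv => absurd (Set.mem_univ v) hv
  have h1 : ContDiffOn ℝ 1 (fderiv ℝ (Tg G f)) {0}ᶜ := by
    rw [show (1 : WithTop ℕ∞) = 0 + 1 from (zero_add 1).symm, contDiffOn_succ_iff_fderiv_of_isOpen ho]
    refine ⟨fun x hx => (hasFDerivAt_fderiv_Tg hG hG₁ hG₂ hf
      hx).differentiableAt.differentiableWithinAt, by simp, contDiffOn_zero.2 ?_⟩
    exact (continuousOn_const.clm_comp hH).congr fun x hx =>
      (hasFDerivAt_fderiv_Tg hG hG₁ hG₂ hf hx).fderiv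
  rw [show (2 : WithTop ℕ∞) = 1 + 1 from one_add_one_eq_two.symm, contDiffOn_succ_iff_fderiv_of_isOpen ho]
  exact ⟨fun x hx => (hasFDerivAt_Tg hG hf hGc₁ hx).differentiableAt.differentiableWithinAt,
    by simp, h1⟩

theorem hessE_Tg {G G₁ G₂ : ℝ → ℝ} (hG : ∀ t, HasDerivAt G (G₁ t) t)
    (hG₁ : ∀ t, HasDerivAt G₁ (G₂ t) t) (hG₂ : Continuous G₂)
    {f : En n → ℝ} (hf : ContinuousOn f (sphere (0 : En n) 1))
    {x : En n} (hx : x ≠ 0) (j l : Fin n) :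
    hessE (Tg G f) x j l =
      ∫ v : Sph n, f v * zonalHess G G₁ G₂ x (v : En n) (EuclideanSpace.single j 1) l
        ∂(sphVol n) := by
  have hGc : Continuous G := continuous_iff_continuousAt.2 fun t => (hG t).continuousAt
  have hGc₁ : Continuous G₁ := continuous_iff_continuousAt.2 fun t => (hG₁ t).continuousAt
  have hint := integrable_smul_of_continuousOn_prod hf (continuousOn_zonalHess hGc hGc₁ hG₂) hx
  rw [hessE, iteratedFDeriv_two_apply, (hasFDerivAt_fderiv_Tg hG hG₁ hG₂ hf hx).fderiv]
  have h := ((EuclideanSpace.proj l : En n →L[ℝ] ℝ) ∘L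
    ContinuousLinearMap.apply ℝ (En n) (EuclideanSpace.single j (1 : ℝ))).integral_comp_comm hint
  simp only [ContinuousLinearMap.comp_apply, ContinuousLinearMap.apply_apply] at h
  change inner ℝ (_ : En n) (_ : En n) = _
  simpa [EuclideanSpace.inner_single_right] using h.symm

theorem zonalHess_single_apply (G G₁ G₂ : ℝ → ℝ) {u : En n} (hu : ‖u‖ = 1) (v : En n)
    (j l : Fin n) :
    zonalHess G G₁ G₂ u v (EuclideanSpace.single j 1) l =
      G ⟪u, v⟫_ℝ * ((if j = l then (1 : ℝ) else 0) - u j * u l) -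
        G₁ ⟪u, v⟫_ℝ * ⟪u, v⟫_ℝ * ((if j = l then (1 : ℝ) else 0) - u j * u l) +
        G₂ ⟪u, v⟫_ℝ * ((v j - ⟪u, v⟫_ℝ * u j) * (v l - ⟪u, v⟫_ℝ * u l)) := by
  have h : (EuclideanSpace.single j (1 : ℝ) : En n) l = if j = l then 1 else 0 := by
    simp [eq_comm]
  simp only [zonalHess, radialProjDeriv, hu, inv_one, one_smul, add_apply, smul_apply, sub_apply,
    ContinuousLinearMap.smulRight_apply, ContinuousLinearMap.comp_apply,
    ContinuousLinearMap.id_apply, innerSL_apply_apply, inner_sub_right, real_inner_smul_right,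
    PiLp.add_apply, PiLp.sub_apply, PiLp.smul_apply, smul_eq_mul, h,
    EuclideanSpace.inner_single_right, real_inner_comm u v]
  simp
  ring

/-- The Hessian entries of the 1-homogeneous extension of `T_g f`. -/
theorem hessian_entries_of_Tg
    (n : ℕ) (hn : 2 ≤ n) (g : ℝ → ℝ) (hg : ContDiffOn ℝ 2 g (Set.Icc (-1) 1))
    (f : En n → ℝ) (hf : ContinuousOn f (sphere (0 : En n) 1)) :
    ContDiffOn ℝ 2 (Tg g f) {0}ᶜ ∧
    ∀ u : En n, ‖u‖ = 1 → ∀ j l : Fin n,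
      hessE (Tg g f) u j l =
        ∫ v : Sph n,
          (g ⟪u, (v : En n)⟫_ℝ * ((if j = l then (1 : ℝ) else 0) - u j * u l) -
            derivWithin g (Set.Icc (-1) 1) ⟪u, (v : En n)⟫_ℝ * ⟪u, (v : En n)⟫_ℝ *
              ((if j = l then (1 : ℝ) else 0) - u j * u l) +
            derivWithin (derivWithin g (Set.Icc (-1) 1)) (Set.Icc (-1) 1)
                ⟪u, (v : En n)⟫_ℝ *
              (((v : En n) j - ⟪u, (v : En n)⟫_ℝ * u j) *
                ((v : En n) l - ⟪u, (v : En n)⟫_ℝ * u l))) * f (v : En n)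
          ∂(sphVol n) := by
  obtain ⟨G, G₁, G₂, hG, hG₁, hG₂, h0, h1, h2⟩ :=
    exists_C2_extension_Icc (by norm_num : (-1 : ℝ) < 1) hg
  rw [Tg_congr h0 f]
  refine ⟨contDiffOn_two_Tg hG hG₁ hG₂ hf, fun u hu j l => ?_⟩
  have hu0 : u ≠ 0 := norm_ne_zero_iff.1 (by simp [hu])
  rw [hessE_Tg hG hG₁ hG₂ hf hu0]
  refine integral_congr_ae (Eventually.of_forall fun v => ?_)
  have hv := inner_radialProj_mem_Icc hu0 v
  rw [hu, inv_one, one_smul] at hv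
  simp only [zonalHess_single_apply G G₁ G₂ hu, h0 hv, h1 hv, h2 hv]
  ring

end MinkIter
end
end

section
/- Let n ≥ 2, let u ∈ 𝕊^{n−1}, and let A₁,…,A_{n−1} be symmetric n×n real matrices each satisfying A_k u = 0. Then D_{n−1}(A₁|_{u⊥},…,A_{n−1}|_{u⊥}) = n·D_n(u⊗u, A₁,…,A_{n−1}), where A_k|_{u⊥} denotes the restriction of A_k to the hyperplane u⊥ (a symmetric (n−1)×(n−1) matrix), and D_{n−1}, D_n denote the mixed discriminants of (n−1)×(n−1) and n×n symmetric matrices respectively. -/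
open scoped InnerProductSpace Pointwise
open MeasureTheory Metric Filter Topology

noncomputable section

namespace MinkIter

variable {n : ℕ}

theorem inner_toEuclideanLin_eq_mul_transpose {ι κ : Type*} [Fintype κ] [DecidableEq κ]
    (p : ι → EuclideanSpace ℝ κ) (M : Matrix κ κ ℝ) (i j : ι) :
    ((Matrix.of fun i => (p i : κ → ℝ)) * M * (Matrix.of fun i => (p i : κ → ℝ)).transpose) i j =
      ⟪p i, Matrix.toEuclideanLin M (p j)⟫_ℝ := by
  rw [Matrix.mul_assoc, Matrix.mul_apply, PiLp.inner_apply]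
  refine Finset.sum_congr rfl fun k _ => ?_
  simp [Matrix.mul_apply, Matrix.mulVec, dotProduct, mul_comm]

/-- The determinant of a matrix may be computed in any orthonormal family of full size. -/
theorem det_inner_toEuclideanLin {κ : Type*} [Fintype κ] [DecidableEq κ]
    (p : κ → EuclideanSpace ℝ κ) (hp : Orthonormal ℝ p) (M : Matrix κ κ ℝ) :
    (Matrix.of fun i j => ⟪p i, Matrix.toEuclideanLin M (p j)⟫_ℝ).det = M.det := by
  have hP : (Matrix.of fun i => (p i : κ → ℝ)) *
      (Matrix.of fun i => (p i : κ → ℝ)).transpose = 1 := by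
    ext i j
    have h := inner_toEuclideanLin_eq_mul_transpose p 1 i j
    rw [Matrix.mul_one] at h
    rw [h, Matrix.one_apply, Matrix.toLpLin_one, LinearMap.id_apply]
    exact orthonormal_iff_ite.mp hp i j
  have hM : (Matrix.of fun i j => ⟪p i, Matrix.toEuclideanLin M (p j)⟫_ℝ) =
      (Matrix.of fun i => (p i : κ → ℝ)) * M *
        (Matrix.of fun i => (p i : κ → ℝ)).transpose := by
    ext i j
    exact (inner_toEuclideanLin_eq_mul_transpose p M i j).symm
  have hd := congrArg Matrix.det hP
  rw [Matrix.det_mul, Matrix.det_one] at hd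
  rw [hM, Matrix.det_mul, Matrix.det_mul, mul_right_comm, hd, one_mul]

theorem toEuclideanLin_outer (u v : En n) :
    Matrix.toEuclideanLin (outer u) v = ⟪u, v⟫_ℝ • u := by
  ext i
  simp only [Matrix.ofLp_toLpLin, Matrix.toLin'_apply, Matrix.mulVec, dotProduct, outer,
    Matrix.of_apply, PiLp.smul_apply, PiLp.inner_apply, smul_eq_mul, Finset.sum_mul]
  refine Finset.sum_congr rfl fun k _ => ?_
  simp only [RCLike.inner_apply, conj_trivial]
  ring

/-- A unit vector followed by an orthonormal basis of its orthogonal complement. -/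
theorem orthonormal_cons_orthogonal {E : Type*} [NormedAddCommGroup E] [InnerProductSpace ℝ E]
    {N : ℕ} {u : E} (hu : ‖u‖ = 1) (b : OrthonormalBasis (Fin N) ℝ ((ℝ ∙ u)ᗮ : Submodule ℝ E)) :
    Orthonormal ℝ (Fin.cons u (fun i => (b i : E)) : Fin (N + 1) → E) := by
  have hub : ∀ i, ⟪u, (b i : E)⟫_ℝ = 0 := fun i =>
    Submodule.mem_orthogonal_singleton_iff_inner_right.mp (b i).2
  rw [orthonormal_iff_ite]
  intro i j
  refine Fin.cases ?_ (fun i => ?_) i <;> refine Fin.cases ?_ (fun j => ?_) j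
  · simp [hu]
  · simp [hub, (Fin.succ_ne_zero j).symm]
  · simp [real_inner_comm, hub]
  · simpa using orthonormal_iff_ite.mp b.orthonormal i j

theorem det_smul_outer_add {N : ℕ} {u : En (N + 1)} (hu : ‖u‖ = 1)
    (b : OrthonormalBasis (Fin N) ℝ ((ℝ ∙ u)ᗮ : Submodule ℝ (En (N + 1)))) (c : ℝ)
    {B : Matrix (Fin (N + 1)) (Fin (N + 1)) ℝ} (hB : Matrix.toEuclideanLin B u = 0) :
    (c • outer u + B).det = c * (Matrix.of fun j l =>
      ⟪(b j : En (N + 1)), Matrix.toEuclideanLin B (b l : En (N + 1))⟫_ℝ).det := by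
  have hub : ∀ i, ⟪u, (b i : En (N + 1))⟫_ℝ = 0 := fun i =>
    Submodule.mem_orthogonal_singleton_iff_inner_right.mp (b i).2
  rw [← det_inner_toEuclideanLin _ (orthonormal_cons_orthogonal hu b),
    Matrix.det_succ_column_zero, Fin.sum_univ_succ, Finset.sum_eq_zero, add_zero]
  · congr 1
    · simp [toEuclideanLin_outer, hB, hu, inner_smul_right]
    · congr 1
      ext j l
      simp [toEuclideanLin_outer, hub]
  · intro i _
    simp [toEuclideanLin_outer, hB, hu, inner_smul_right, real_inner_comm, hub]

/-- A sum over the subsets of `Fin (N + 1)`, split according to whether they contain `0`. -/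
theorem sum_finset_fin_succ {M : Type*} [AddCommMonoid M] {N : ℕ}
    (f : Finset (Fin (N + 1)) → M) :
    ∑ S, f S = (∑ S : Finset (Fin N), f (S.map (Fin.succEmb N))) +
      ∑ S : Finset (Fin N), f (insert 0 (S.map (Fin.succEmb N))) := by
  have hinj : Function.Injective fun S : Finset (Fin N) => S.image Fin.succ :=
    Finset.image_injective (Fin.succ_injective N)
  have h0 : (0 : Fin (N + 1)) ∉ Finset.univ.image (Fin.succ : Fin N → Fin (N + 1)) := by
    simp
  have hu : (Finset.univ : Finset (Fin (N + 1))) =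
      insert 0 (Finset.univ.image (Fin.succ : Fin N → Fin (N + 1))) := by
    ext i
    cases i using Fin.cases <;> simp
  rw [← Finset.powerset_univ, hu, Finset.sum_powerset_insert h0, Finset.powerset_image,
    Finset.sum_image hinj.injOn, Finset.sum_image hinj.injOn, Finset.powerset_univ]
  simp [Finset.map_eq_image]

/-- Dimension reduction for mixed discriminants with a first argument `u ⊗ u`. -/
theorem mixedDisc_restrict_eq_mul_mixedDisc_cons {N : ℕ} {u : En (N + 1)} (hu : ‖u‖ = 1)
    (b : OrthonormalBasis (Fin N) ℝ ((ℝ ∙ u)ᗮ : Submodule ℝ (En (N + 1))))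
    (A : Fin N → Matrix (Fin (N + 1)) (Fin (N + 1)) ℝ)
    (hker : ∀ k, Matrix.toEuclideanLin (A k) u = 0) :
    mixedDisc (fun k => Matrix.of fun j l : Fin N =>
        ⟪(b j : En (N + 1)), Matrix.toEuclideanLin (A k) (b l : En (N + 1))⟫_ℝ) =
      ((N + 1 : ℕ) : ℝ) * mixedDisc (Fin.cons (outer u) A) := by
  have hkerS : ∀ S : Finset (Fin N), Matrix.toEuclideanLin (∑ k ∈ S, A k) u = 0 := fun S => by
    rw [map_sum, LinearMap.sum_apply]
    exact Finset.sum_eq_zero fun k _ => hker k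
  have hout := fun S => det_smul_outer_add hu b 0 (hkerS S)
  have hin := fun S => det_smul_outer_add hu b 1 (hkerS S)
  simp only [zero_smul, zero_add, zero_mul, one_smul, one_mul] at hout hin
  have hmem : ∀ S : Finset (Fin N), (0 : Fin (N + 1)) ∉ S.map (Fin.succEmb N) := fun S => by
    simp [Fin.succ_ne_zero]
  have hrestr : ∀ S : Finset (Fin N),
      (∑ k ∈ S, Matrix.of fun j l : Fin N =>
        ⟪(b j : En (N + 1)), Matrix.toEuclideanLin (A k) (b l : En (N + 1))⟫_ℝ) =
      Matrix.of fun j l : Fin N =>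
        ⟪(b j : En (N + 1)), Matrix.toEuclideanLin (∑ k ∈ S, A k) (b l : En (N + 1))⟫_ℝ :=
    fun S => by
      ext j l
      simp only [Matrix.sum_apply, Matrix.of_apply, map_sum, LinearMap.sum_apply, inner_sum]
  unfold mixedDisc
  rw [sum_finset_fin_succ]
  simp only [Finset.sum_insert (hmem _), Finset.card_insert_of_notMem (hmem _), Finset.sum_map,
    Finset.card_map, Fin.coe_succEmb, Fin.cons_zero, Fin.cons_succ, hout, hin, hrestr, mul_zero,
    Finset.sum_const_zero, zero_add, Nat.add_sub_add_right, Nat.factorial_succ]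
  push_cast
  field_simp

/-- The dimension reduction identity for mixed discriminants:
`D_{n-1}(A₁|_{u^⊥},…,A_{n-1}|_{u^⊥}) = n · D_n(u ⊗ u, A₁,…,A_{n-1})` for symmetric
matrices annihilating `u`. -/
theorem mixed_discriminant_restriction
    (n : ℕ) (hn : 2 ≤ n) (u : En n) (hu : ‖u‖ = 1)
    (A : Fin (n - 1) → Matrix (Fin n) (Fin n) ℝ)
    (hsymA : ∀ k, (A k).IsSymm)
    (hker : ∀ k, Matrix.toEuclideanLin (A k) u = 0)
    (b : OrthonormalBasis (Fin (n - 1)) ℝ ((ℝ ∙ u)ᗮ : Submodule ℝ (En n))) :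
    mixedDisc (fun k : Fin (n - 1) => Matrix.of fun j l : Fin (n - 1) =>
        ⟪((b j : ((ℝ ∙ u)ᗮ : Submodule ℝ (En n))) : En n),
          Matrix.toEuclideanLin (A k) ((b l : ((ℝ ∙ u)ᗮ : Submodule ℝ (En n))) : En n)⟫_ℝ) =
      n * mixedDisc (fun k : Fin n =>
        if h : (k : ℕ) = 0 then outer u
        else A ⟨(k : ℕ) - 1, by have := k.isLt; omega⟩) := by
  obtain ⟨N, rfl⟩ : ∃ N, n = N + 1 := ⟨n - 1, by omega⟩
  have hcons : (fun k : Fin (N + 1) => if h : (k : ℕ) = 0 then outer u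
      else A ⟨(k : ℕ) - 1, by have := k.isLt; omega⟩) =
      (Fin.cons (outer u) A : Fin (N + 1) → Matrix (Fin (N + 1)) (Fin (N + 1)) ℝ) := by
    funext k
    refine Fin.cases ?_ (fun k => ?_) k <;> simp
  rw [hcons]
  exact mixedDisc_restrict_eq_mul_mixedDisc_cons hu b A hker

end MinkIter
end
end
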